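/- Let X be a mixing SFT with measure of maximal entropy μ, F the maximal length of a minimal forbidden word, and s the number of admissible words of length F. For every ε > 0, ℓ ∈ ℕ, and invariant probability measure μ' on X with h_{μ'} > h_top(X) − ε²/((4/3)^{2ℓ} ξ(s)²), where ξ(s) = 30 s^{3(s²+1)}/(1 − (1 − 1/(4 s^{2s²}))^{1/s²}), we have |μ'([w]) − μ([w])| < ε for every admissible word w of length at most ℓ. -/

import Mathlib

open Filter Topology MeasureTheory Set

def shiftMap (A : Type*) : (ℤ → A) → (ℤ → A) := fun x n => x (n + 1)

def occursAt {A : Type*} (x : ℤ → A) (i : ℤ) (w : List A) : Prop :=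
  ∀ j : Fin w.length, x (i + (j : ℕ)) = w.get j

def inLang {A : Type*} (X : Set (ℤ → A)) (w : List A) : Prop :=
  ∃ x ∈ X, occursAt x 0 w

def sftCover {A : Type*} (X : Set (ℤ → A)) (n : ℕ) : Set (ℤ → A) :=
  { x | ∀ (i : ℤ) (w : List A), w.length ≤ n → occursAt x i w → inLang X w }

def IsSubshift {A : Type*} [TopologicalSpace A] (X : Set (ℤ → A)) : Prop :=
  X.Nonempty ∧ IsClosed X ∧ shiftMap A '' X = X

def minPeriodPts {A : Type*} (S : Set (ℤ → A)) (p : ℕ) : Set (ℤ → A) :=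
  { x ∈ S | (shiftMap A)^[p] x = x ∧ ∀ q : ℕ, 0 < q → q < p → (shiftMap A)^[q] x ≠ x }

def PeriodStable {A : Type*} (X : Set (ℤ → A)) : Prop :=
  ∀ m : ℕ, ∃ n p : ℕ, 0 < p ∧
    minPeriodPts (sftCover X n) p = minPeriodPts (sftCover X (n + m)) p

def LanguageStable {A : Type*} (X : Set (ℤ → A)) : Prop :=
  ∀ m : ℕ, ∃ n : ℕ, sftCover X n = sftCover X (n + m)

def TopMixing {A : Type*} (X : Set (ℤ → A)) : Prop :=
  ∀ u v : List A, inLang X u → inLang X v →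
    ∃ N : ℕ, ∀ n ≥ N, ∃ w : List A, w.length = n ∧ inLang X (u ++ w ++ v)

def LangTransitive {A : Type*} (X : Set (ℤ → A)) : Prop :=
  ∀ u v : List A, inLang X u → inLang X v → ∃ w : List A, inLang X (u ++ w ++ v)

def globalSlide {A : Type*} (R : ℕ) (Φ : List A → A) : (ℤ → A) → (ℤ → A) :=
  fun x i => Φ (List.ofFn (fun j : Fin (2 * R + 1) => x (i - R + (j : ℕ))))

def wordSlide {A : Type*} (R : ℕ) (Φ : List A → A) (w : List A) : List A :=
  (List.range (w.length - 2 * R)).map (fun j => Φ ((w.drop j).take (2 * R + 1)))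

noncomputable def subshiftEntropy {A : Type*} (X : Set (ℤ → A)) : ℝ :=
  Filter.limsup
    (fun n : ℕ => Real.log (Nat.card { w : List A // w.length = n ∧ inLang X w }) / n)
    Filter.atTop

def IsNNSFT {A : Type*} (X : Set (ℤ → A)) : Prop :=
  ∃ F : Set (List A), (∀ w ∈ F, w.length ≤ 2) ∧
    X = { x | ∀ (i : ℤ) (w : List A), w ∈ F → ¬ occursAt x i w }

noncomputable def xi (s : ℕ) : ℝ :=
  30 * (s : ℝ) ^ (3 * (s ^ 2 + 1)) /
    (1 - Real.rpow (1 - 1 / (4 * (s : ℝ) ^ (2 * s ^ 2))) (1 / (s ^ 2 : ℝ)))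

noncomputable def measEntropy {A : Type*} [Fintype A] [MeasurableSpace A]
    (μ : MeasureTheory.Measure (ℤ → A)) : ℝ :=
  Filter.limsup
    (fun n : ℕ =>
      (∑ w : Fin n → A,
        Real.negMulLog ((μ { x : ℤ → A | ∀ j : Fin n, x ((j : ℕ) : ℤ) = w j }).toReal)) / n)
    Filter.atTop


lemma sq_sqrt_sub_sqrt_add_sub_le_mul_log_sub_log {p q : ℝ} (hp : 0 ≤ p) (hq : 0 ≤ q)
    (h : q = 0 → p = 0) :
    (√p - √q) ^ 2 + p - q ≤ p * (Real.log p - Real.log q) := by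
  have hp2 := Real.sq_sqrt hp
  have hq2 := Real.sq_sqrt hq
  rcases hp.eq_or_lt with rfl | hp0
  · simp [hq2]
  have hq0 : 0 < q := lt_of_le_of_ne hq fun h' => hp0.ne' (h h'.symm)
  have hsp : 0 < √p := Real.sqrt_pos.2 hp0
  have hsq : 0 < √q := Real.sqrt_pos.2 hq0
  have h1 := Real.log_le_sub_one_of_pos (div_pos hsq hsp)
  rw [Real.log_div hsq.ne' hsp.ne', Real.log_sqrt hq, Real.log_sqrt hp] at h1
  have h2 : p * (√q / √p) = √p * √q := by
    nth_rewrite 1 [← hp2]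
    field_simp
  nlinarith [mul_le_mul_of_nonneg_left h1 hp]

lemma sum_sub_sum_le_sum_mul_log_sub_log {ι : Type*} [Fintype ι] {p q : ι → ℝ}
    (hp : ∀ i, 0 ≤ p i) (hq : ∀ i, 0 ≤ q i) (h : ∀ i, q i = 0 → p i = 0) :
    ∑ i, p i - ∑ i, q i ≤ ∑ i, p i * (Real.log (p i) - Real.log (q i)) := by
  rw [← Finset.sum_sub_distrib]
  refine Finset.sum_le_sum fun i _ => ?_
  have := sq_sqrt_sub_sqrt_add_sub_le_mul_log_sub_log (hp i) (hq i) (h i)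
  nlinarith [sq_nonneg (√(p i) - √(q i))]

/-- A weak form of Pinsker's inequality. -/
lemma sum_abs_sub_le_two_mul_sqrt {ι : Type*} [Fintype ι] {p q : ι → ℝ} {δ : ℝ}
    (hp : ∀ i, 0 ≤ p i) (hq : ∀ i, 0 ≤ q i) (h : ∀ i, q i = 0 → p i = 0)
    (hp1 : ∑ i, p i = 1) (hq1 : ∑ i, q i = 1)
    (hδ : ∑ i, p i * (Real.log (p i) - Real.log (q i)) ≤ δ) :
    ∑ i, |p i - q i| ≤ 2 * √δ := by
  have h1 : ∑ i, (√(p i) - √(q i)) ^ 2 ≤ δ := by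
    have : ∑ i, ((√(p i) - √(q i)) ^ 2 + p i - q i) ≤
        ∑ i, p i * (Real.log (p i) - Real.log (q i)) :=
      Finset.sum_le_sum fun i _ =>
        sq_sqrt_sub_sqrt_add_sub_le_mul_log_sub_log (hp i) (hq i) (h i)
    rw [Finset.sum_sub_distrib, Finset.sum_add_distrib, hp1, hq1] at this
    linarith
  have h2 : ∑ i, (√(p i) + √(q i)) ^ 2 ≤ 4 := by
    have : ∑ i, (√(p i) + √(q i)) ^ 2 ≤ ∑ i, 2 * (p i + q i) := by
      refine Finset.sum_le_sum fun i _ => ?_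
      nlinarith [Real.sq_sqrt (hp i), Real.sq_sqrt (hq i), sq_nonneg (√(p i) - √(q i))]
    rw [← Finset.mul_sum, Finset.sum_add_distrib, hp1, hq1] at this
    linarith
  have h3 := Finset.sum_mul_sq_le_sq_mul_sq Finset.univ (fun i => |√(p i) - √(q i)|)
    (fun i => √(p i) + √(q i))
  have h4 : ∀ i, |√(p i) - √(q i)| * (√(p i) + √(q i)) = |p i - q i| := fun i => by
    rw [← abs_of_nonneg (add_nonneg (Real.sqrt_nonneg (p i)) (Real.sqrt_nonneg (q i))),
      ← abs_mul]
    congr 1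
    nlinarith [Real.sq_sqrt (hp i), Real.sq_sqrt (hq i)]
  simp only [h4, sq_abs] at h3
  have hδ0 : 0 ≤ δ := (Finset.sum_nonneg fun i _ => sq_nonneg _).trans h1
  have h5 : (∑ i, |p i - q i|) ^ 2 ≤ δ * 4 :=
    h3.trans (mul_le_mul h1 h2 (Finset.sum_nonneg fun i _ => sq_nonneg _) hδ0)
  refine abs_le_of_sq_le_sq' ?_ (by positivity) |>.2
  rw [mul_pow, Real.sq_sqrt hδ0]
  linarith

/-- If `E` is strongly connected, any two vertices are joined by a path shorter than the number of
vertices. -/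
lemma exists_one_le_pow_apply {V : Type*} [Fintype V] [DecidableEq V] {M : Matrix V V ℝ}
    (hM : ∀ u v, 0 ≤ M u v) {E : V → V → Prop} (hE : ∀ u v, E u v → 1 ≤ M u v)
    (hconn : ∀ u v, Relation.ReflTransGen E u v) (u v : V) :
    ∃ t < Fintype.card V, 1 ≤ (M ^ t) u v := by
  classical
  have hpow : ∀ t a b, 0 ≤ (M ^ t) a b := by
    intro t
    induction t with
    | zero => intro a b; simp only [pow_zero, Matrix.one_apply]; split_ifs <;> norm_num
    | succ t ih =>
      intro a b
      rw [pow_succ, Matrix.mul_apply]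
      exact Finset.sum_nonneg fun c _ => mul_nonneg (ih a c) (hM c b)
  have hstep : ∀ t a b, 1 ≤ (M ^ t) u a → E a b → 1 ≤ (M ^ (t + 1)) u b := by
    intro t a b ha hab
    rw [pow_succ, Matrix.mul_apply]
    calc (1 : ℝ) ≤ (M ^ t) u a * M a b := one_le_mul_of_one_le_of_one_le ha (hE a b hab)
      _ ≤ _ := Finset.single_le_sum (f := fun c => (M ^ t) u c * M c b)
        (fun c _ => mul_nonneg (hpow t u c) (hM c b)) (Finset.mem_univ a)
  let S : ℕ → Finset V := fun t => Finset.univ.filter fun w => ∃ k ≤ t, 1 ≤ (M ^ k) u w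
  have hu : ∀ t, u ∈ S t := fun t => by
    simp only [S, Finset.mem_filter, Finset.mem_univ, true_and]
    exact ⟨0, Nat.zero_le _, by simp⟩
  have hcard : ∀ t, S t = Finset.univ ∨ t + 1 ≤ (S t).card := by
    intro t
    induction t with
    | zero => exact Or.inr (Finset.card_pos.2 ⟨u, hu 0⟩)
    | succ t ih =>
      have hsub : S t ⊆ S (t + 1) := fun w hw => by
        simp only [S, Finset.mem_filter, Finset.mem_univ, true_and] at hw ⊢
        obtain ⟨k, hk, h⟩ := hw
        exact ⟨k, by omega, h⟩
      by_cases hclosed : ∀ a ∈ S t, ∀ b, E a b → b ∈ S t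
      · left
        refine Finset.eq_univ_iff_forall.2 fun w => hsub ?_
        induction hconn u w with
        | refl => exact hu t
        | tail _ hab ih => exact hclosed _ ih _ hab
      · push Not at hclosed
        obtain ⟨a, ha, b, hab, hb⟩ := hclosed
        have hb' : b ∈ S (t + 1) := by
          simp only [S, Finset.mem_filter, Finset.mem_univ, true_and] at ha ⊢
          obtain ⟨k, hk, h⟩ := ha
          exact ⟨k + 1, by omega, hstep k a b h hab⟩
        rcases ih with ih | ih
        · exact absurd (ih ▸ Finset.mem_univ b) hb
        · right
          have := Finset.card_lt_card (Finset.ssubset_iff_subset_ne.2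
            ⟨hsub, fun h => hb (h ▸ hb')⟩)
          omega
  have hpos : 0 < Fintype.card V := Fintype.card_pos_iff.2 ⟨u⟩
  have huniv : S (Fintype.card V - 1) = Finset.univ := by
    rcases hcard (Fintype.card V - 1) with h | h
    · exact h
    · refine Finset.eq_univ_of_card _ (le_antisymm (Finset.card_le_univ _) (by omega))
  have hv : v ∈ S (Fintype.card V - 1) := huniv ▸ Finset.mem_univ v
  simp only [S, Finset.mem_filter, Finset.mem_univ, true_and] at hv
  obtain ⟨k, hk, h⟩ := hv
  exact ⟨k, by omega, h⟩

lemma Matrix.mulVec_nonneg_of_nonneg {V : Type*} [Fintype V] {M : Matrix V V ℝ}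
    (hM : ∀ u v, 0 ≤ M u v) {x : V → ℝ} (hx : ∀ v, 0 ≤ x v) (u : V) : 0 ≤ (M.mulVec x) u :=
  Finset.sum_nonneg fun v _ => mul_nonneg (hM u v) (hx v)

/-- Perron's theorem: an irreducible nonnegative matrix has a positive eigenvector. -/
lemma exists_pos_eigenvector {V : Type*} [Fintype V] [DecidableEq V] [Nonempty V]
    {M : Matrix V V ℝ} (hM : ∀ u v, 0 ≤ M u v) {B : Matrix V V ℝ} (hB : ∀ u v, 0 < B u v)
    (hcomm : Commute M B) :
    ∃ (lam : ℝ) (r : V → ℝ), (∀ v, 0 < r v) ∧ M.mulVec r = lam • r := by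
  classical
  set C : ℝ := ∑ u, ∑ v, M u v with hC
  have hC0 : 0 ≤ C := Finset.sum_nonneg fun u _ => Finset.sum_nonneg fun v _ => hM u v
  let K : Set (ℝ × (V → ℝ)) :=
    (Set.Icc 0 C ×ˢ stdSimplex ℝ V) ∩ {z | ∀ u, z.1 * z.2 u ≤ (M.mulVec z.2) u}
  have hKc : IsCompact K := by
    refine (isCompact_Icc.prod (isCompact_stdSimplex ℝ V)).inter_right ?_
    simp only [Set.ofPred_forall, Matrix.mulVec, dotProduct]
    exact isClosed_iInter fun u => isClosed_le (by fun_prop) (by fun_prop)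
  have hBpos : ∀ x : V → ℝ, (∀ v, 0 ≤ x v) → x ≠ 0 → ∀ u, 0 < (B.mulVec x) u := by
    intro x hx hx0 u
    obtain ⟨v, hv⟩ := Function.ne_iff.1 hx0
    exact Finset.sum_pos' (fun w _ => mul_nonneg (hB u w).le (hx w))
      ⟨v, Finset.mem_univ v, mul_pos (hB u v) (lt_of_le_of_ne (hx v) (Ne.symm hv))⟩
  have hmemK : ∀ (lam : ℝ) (y : V → ℝ), 0 ≤ lam → (∀ v, 0 < y v) →
      (∀ u, lam * y u ≤ (M.mulVec y) u) → (lam, (∑ v, y v)⁻¹ • y) ∈ K := by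
    intro lam y hlam hy h
    have hsum : 0 < ∑ v, y v := Finset.sum_pos (fun v _ => hy v) Finset.univ_nonempty
    have hle : ∀ u, lam * y u ≤ ∑ v, M u v * y v := h
    refine ⟨⟨⟨hlam, ?_⟩, fun v => ?_, ?_⟩, fun u => ?_⟩
    · have h1 : lam * ∑ v, y v ≤ C * ∑ v, y v := by
        rw [Finset.mul_sum, hC, Finset.sum_mul]
        refine Finset.sum_le_sum fun u _ => (hle u).trans ?_
        rw [Finset.sum_mul]
        exact Finset.sum_le_sum fun v _ => mul_le_mul_of_nonneg_left
          (Finset.single_le_sum (fun w _ => (hy w).le) (Finset.mem_univ v)) (hM u v)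
      exact le_of_mul_le_mul_right h1 hsum
    · simp only [Pi.smul_apply, smul_eq_mul]
      exact mul_nonneg (inv_nonneg.2 hsum.le) (hy v).le
    · simp only [Pi.smul_apply, smul_eq_mul, ← Finset.mul_sum]
      exact inv_mul_cancel₀ hsum.ne'
    · simp only [Matrix.mulVec_smul, Pi.smul_apply, smul_eq_mul]
      have := mul_le_mul_of_nonneg_left (h u) (inv_nonneg.2 hsum.le)
      linarith
  have hKne : K.Nonempty :=
    ⟨_, hmemK 0 1 le_rfl (fun _ => one_pos) fun u => by
      simpa using Matrix.mulVec_nonneg_of_nonneg hM (x := 1) (fun _ => zero_le_one) u⟩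
  obtain ⟨⟨lam, x⟩, ⟨⟨hlam, hx⟩, hxle⟩, hmax⟩ :=
    hKc.exists_isMaxOn hKne continuous_fst.continuousOn
  have hx0 : x ≠ 0 := by
    rintro rfl
    simpa using hx.2
  have hyp := hBpos x hx.1 hx0
  have hBM : B.mulVec (M.mulVec x) = M.mulVec (B.mulVec x) := by
    rw [Matrix.mulVec_mulVec, Matrix.mulVec_mulVec, hcomm.eq]
  have heig : M.mulVec x = lam • x := by
    by_contra hne
    have hz := hBpos (M.mulVec x - lam • x)
      (fun v => by simpa using hxle v) (sub_ne_zero.2 hne)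
    simp only [Matrix.mulVec_sub, Matrix.mulVec_smul, hBM, Pi.sub_apply, Pi.smul_apply,
      smul_eq_mul] at hz
    obtain ⟨u, hu⟩ := Finite.exists_min fun u =>
      ((M.mulVec (B.mulVec x)) u - lam * (B.mulVec x) u) / (B.mulVec x) u
    set c := ((M.mulVec (B.mulVec x)) u - lam * (B.mulVec x) u) / (B.mulVec x) u
    have hc : 0 < c := div_pos (hz u) (hyp u)
    have hmem := hmemK (lam + c) (B.mulVec x) (add_nonneg hlam.1 hc.le) hyp fun v => by
      have := (le_div_iff₀ (hyp v)).1 (hu v)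
      linarith
    have := hmax hmem
    simp only [Set.mem_ofPred_eq] at this
    linarith
  refine ⟨lam, B.mulVec x, hyp, ?_⟩
  rw [← hBM, heig, Matrix.mulVec_smul]

/-- Perturbation bound for the stationary vector of a stochastic matrix. -/
lemma mul_sum_abs_le_of_sum_abs_sub_vecMul_le {V : Type*} [Fintype V] [DecidableEq V]
    {P : Matrix V V ℝ} (hP : ∀ u v, 0 ≤ P u v) (hP1 : ∀ u, ∑ v, P u v = 1)
    {c : ℝ} (hc : ∀ u v, ∃ t < Fintype.card V, c ≤ (P ^ t) u v)
    {d : V → ℝ} (hd : ∑ v, d v = 0) {η : ℝ}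
    (hη : ∑ v, |d v - (Matrix.vecMul d P) v| ≤ η) :
    c * ∑ v, |d v| ≤ Fintype.card V * η := by
  rcases isEmpty_or_nonempty V with hV | hV
  · simp
  have hη0 : 0 ≤ η := (Finset.sum_nonneg fun _ _ => abs_nonneg _).trans hη
  set s := Fintype.card V with hs
  have hs0 : (0 : ℝ) < s := by exact_mod_cast Fintype.card_pos
  have hnonneg : ∀ t u v, 0 ≤ (P ^ t) u v := by
    intro t
    induction t with
    | zero => intro a b; simp only [pow_zero, Matrix.one_apply]; split_ifs <;> norm_num
    | succ t ih =>
      intro a b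
      rw [pow_succ, Matrix.mul_apply]
      exact Finset.sum_nonneg fun c _ => mul_nonneg (ih a c) (hP c b)
  have hrow : ∀ t u, ∑ v, (P ^ t) u v = 1 := by
    intro t
    induction t with
    | zero => intro u; simp [Matrix.one_apply]
    | succ t ih =>
      intro u
      simp only [pow_succ, Matrix.mul_apply]
      rw [Finset.sum_comm]
      simp only [← Finset.mul_sum, hP1, mul_one, ih]
  have hcontr : ∀ e : V → ℝ, ∑ v, |(Matrix.vecMul e P) v| ≤ ∑ v, |e v| := by
    intro e
    calc ∑ v, |(Matrix.vecMul e P) v| ≤ ∑ v, ∑ u, |e u| * P u v := by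
          refine Finset.sum_le_sum fun v _ => (Finset.abs_sum_le_sum_abs _ _).trans_eq ?_
          exact Finset.sum_congr rfl fun u _ => by rw [abs_mul, abs_of_nonneg (hP u v)]
      _ = ∑ u, |e u| := by
          rw [Finset.sum_comm]
          simp only [← Finset.mul_sum, hP1, mul_one]
  have hiter : ∀ t : ℕ, ∑ v, |d v - (Matrix.vecMul d (P ^ t)) v| ≤ t * η := by
    intro t
    induction t with
    | zero => simp
    | succ t ih =>
      have heq : ∀ v, d v - (Matrix.vecMul d (P ^ (t + 1))) v =
          (d v - (Matrix.vecMul d P) v) +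
            (Matrix.vecMul (d - Matrix.vecMul d (P ^ t)) P) v := by
        intro v
        rw [Matrix.sub_vecMul, Matrix.vecMul_vecMul, ← pow_succ, Pi.sub_apply]
        ring
      calc ∑ v, |d v - (Matrix.vecMul d (P ^ (t + 1))) v|
          ≤ ∑ v, (|d v - (Matrix.vecMul d P) v| +
            |(Matrix.vecMul (d - Matrix.vecMul d (P ^ t)) P) v|) :=
            Finset.sum_le_sum fun v _ => by rw [heq]; exact abs_add_le _ _
        _ ≤ η + t * η := by
            rw [Finset.sum_add_distrib]
            exact add_le_add hη ((hcontr _).trans ih)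
        _ = _ := by push_cast; ring
  set S : Matrix V V ℝ := ∑ t ∈ Finset.range s, P ^ t with hS
  have hSapp : ∀ u v, S u v = ∑ t ∈ Finset.range s, (P ^ t) u v := fun u v => by
    rw [hS, Matrix.sum_apply]
  have hSc : ∀ u v, c ≤ S u v := by
    intro u v
    obtain ⟨t, ht, h⟩ := hc u v
    rw [hSapp]
    exact h.trans (Finset.single_le_sum (f := fun t => (P ^ t) u v)
      (fun t _ => hnonneg t u v) (Finset.mem_range.2 ht))
  have hSrow : ∀ u, ∑ v, S u v = s := by
    intro u
    simp only [hSapp]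
    rw [Finset.sum_comm]
    simp [hrow]
  have h1 : ∑ v, |(Matrix.vecMul d S) v| ≤ (s - s * c) * ∑ v, |d v| := by
    have heq : ∀ v, (Matrix.vecMul d S) v = ∑ u, d u * (S u v - c) := by
      intro v
      simp only [mul_sub, Finset.sum_sub_distrib, ← Finset.sum_mul, hd, zero_mul, sub_zero]
      rfl
    calc ∑ v, |(Matrix.vecMul d S) v| ≤ ∑ v, ∑ u, |d u| * (S u v - c) := by
          refine Finset.sum_le_sum fun v _ => ?_
          rw [heq]
          refine (Finset.abs_sum_le_sum_abs _ _).trans_eq ?_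
          exact Finset.sum_congr rfl fun u _ => by
            rw [abs_mul, abs_of_nonneg (sub_nonneg.2 (hSc u v))]
      _ = _ := by
          rw [Finset.sum_comm, Finset.mul_sum]
          refine Finset.sum_congr rfl fun u _ => ?_
          rw [← Finset.mul_sum, Finset.sum_sub_distrib, hSrow]
          simp [hs, mul_comm]
  have h2 : ∑ v, |s * d v - (Matrix.vecMul d S) v| ≤ s * (s * η) := by
    have heq : ∀ v, s * d v - (Matrix.vecMul d S) v =
        ∑ t ∈ Finset.range s, (d v - (Matrix.vecMul d (P ^ t)) v) := by
      intro v
      rw [Finset.sum_sub_distrib, hS, Matrix.vecMul_sum]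
      simp
    calc ∑ v, |s * d v - (Matrix.vecMul d S) v|
        ≤ ∑ v, ∑ t ∈ Finset.range s, |d v - (Matrix.vecMul d (P ^ t)) v| :=
          Finset.sum_le_sum fun v _ => by rw [heq]; exact Finset.abs_sum_le_sum_abs _ _
      _ = ∑ t ∈ Finset.range s, ∑ v, |d v - (Matrix.vecMul d (P ^ t)) v| := Finset.sum_comm
      _ ≤ ∑ t ∈ Finset.range s, s * η := by
          refine Finset.sum_le_sum fun t ht => (hiter t).trans ?_
          exact mul_le_mul_of_nonneg_right
            (by exact_mod_cast (Finset.mem_range.1 ht).le) hη0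
      _ = _ := by simp
  have h3 : s * ∑ v, |d v| ≤ s * (s * η) + (s - s * c) * ∑ v, |d v| := by
    calc s * ∑ v, |d v| = ∑ v, |s * d v| := by
          rw [Finset.mul_sum]
          exact Finset.sum_congr rfl fun v _ => by rw [abs_mul, abs_of_pos hs0]
      _ ≤ ∑ v, (|s * d v - (Matrix.vecMul d S) v| + |(Matrix.vecMul d S) v|) :=
          Finset.sum_le_sum fun v _ => by
            simpa using abs_add_le (s * d v - (Matrix.vecMul d S) v) ((Matrix.vecMul d S) v)
      _ ≤ _ := by rw [Finset.sum_add_distrib]; exact add_le_add h2 h1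
  have h4 : s * (c * ∑ v, |d v|) ≤ s * (s * η) := by linarith
  exact le_of_mul_le_mul_left h4 hs0

abbrev wsnoc {A : Type*} {n : ℕ} (w : Fin n → A) (a : A) : Fin (n + 1) → A :=
  Fin.snoc (α := fun _ => A) w a

abbrev wcons {A : Type*} {n : ℕ} (a : A) (w : Fin n → A) : Fin (n + 1) → A :=
  Fin.cons (α := fun _ => A) a w

/-- The last `F` letters of a word. -/
def wsuffix {A : Type*} {n F : ℕ} (h : F ≤ n) (w : Fin n → A) : Fin F → A :=
  fun j => w ⟨n - F + j, by omega⟩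

section Words

variable {A : Type*}

lemma wsnoc_apply {n : ℕ} (w : Fin n → A) (a : A) (j : Fin (n + 1)) :
    wsnoc w a j = if h : (j : ℕ) < n then w ⟨j, h⟩ else a := by
  simp [wsnoc, Fin.snoc, Fin.castLT]

lemma wcons_wsnoc {n : ℕ} (b : A) (w : Fin n → A) (a : A) :
    wcons b (wsnoc w a) = wsnoc (wcons b w) a :=
  Fin.cons_snoc_eq_snoc_cons (β := A) b w a

lemma wsuffix_self {n : ℕ} (w : Fin n → A) : wsuffix le_rfl w = w := by
  ext j
  simp [wsuffix]

lemma wsuffix_wcons {n F : ℕ} (h : F ≤ n) (a : A) (w : Fin n → A) :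
    wsuffix (h.trans n.le_succ) (wcons a w) = wsuffix h w := by
  ext j
  have : (⟨n + 1 - F + j, by omega⟩ : Fin (n + 1)) =
      Fin.succ (⟨n - F + j, by omega⟩ : Fin n) := by
    ext
    simp
    omega
  simp only [wsuffix, this, wcons, Fin.cons_succ]

lemma wsuffix_wsnoc {n F : ℕ} (h : F ≤ n) (w : Fin n → A) (a : A) :
    wsuffix (h.trans n.le_succ) (wsnoc w a) = Fin.tail (wsnoc (wsuffix h w) a) := by
  ext j
  simp only [wsuffix, Fin.tail, wsnoc_apply, Fin.val_succ]
  by_cases hj : (j : ℕ) + 1 < F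
  · rw [dif_pos (by omega), dif_pos hj]
    congr 2
    omega
  · rw [dif_neg (by omega), dif_neg hj]

variable [Fintype A]

lemma sum_wsnoc {n : ℕ} (φ : (Fin (n + 1) → A) → ℝ) :
    ∑ w, φ w = ∑ w : Fin n → A, ∑ a, φ (wsnoc w a) := by
  rw [← (Fin.snocEquiv fun _ : Fin (n + 1) => A).sum_comp, Fintype.sum_prod_type,
    Finset.sum_comm]
  rfl

lemma sum_wcons {n : ℕ} (φ : (Fin (n + 1) → A) → ℝ) :
    ∑ w, φ w = ∑ w : Fin n → A, ∑ a, φ (wcons a w) := by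
  rw [← (Fin.consEquiv fun _ : Fin (n + 1) => A).sum_comp, Fintype.sum_prod_type,
    Finset.sum_comm]
  rfl

/-- The finite-dimensional distributions of a stationary process. -/
structure IsStationaryFamily (f : ∀ n, (Fin n → A) → ℝ) : Prop where
  nonneg : ∀ n w, 0 ≤ f n w
  sum_snoc : ∀ n (w : Fin n → A), ∑ a, f (n + 1) (wsnoc w a) = f n w
  sum_cons : ∀ n (w : Fin n → A), ∑ a, f (n + 1) (wcons a w) = f n w
  total : ∑ w, f 0 w = 1

noncomputable def blockEntropy (f : ∀ n, (Fin n → A) → ℝ) (n : ℕ) : ℝ :=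
  ∑ w, Real.negMulLog (f n w)

namespace IsStationaryFamily

variable {f : ∀ n, (Fin n → A) → ℝ} (hf : IsStationaryFamily f)
include hf

lemma sum_eq_one (n : ℕ) : ∑ w, f n w = 1 := by
  induction n with
  | zero => exact hf.total
  | succ n ih => simpa only [sum_wsnoc, hf.sum_snoc] using ih

lemma wsnoc_le {n : ℕ} (w : Fin n → A) (a : A) : f (n + 1) (wsnoc w a) ≤ f n w := by
  rw [← hf.sum_snoc n w]
  exact Finset.single_le_sum (f := fun a => f (n + 1) (wsnoc w a))
    (fun a _ => hf.nonneg _ _) (Finset.mem_univ a)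

lemma wcons_le {n : ℕ} (a : A) (w : Fin n → A) : f (n + 1) (wcons a w) ≤ f n w := by
  rw [← hf.sum_cons n w]
  exact Finset.single_le_sum (f := fun a => f (n + 1) (wcons a w))
    (fun a _ => hf.nonneg _ _) (Finset.mem_univ a)

lemma le_one (n : ℕ) (w : Fin n → A) : f n w ≤ 1 := by
  rw [← hf.sum_eq_one n]
  exact Finset.single_le_sum (fun w _ => hf.nonneg _ w) (Finset.mem_univ w)

lemma blockEntropy_nonneg (n : ℕ) : 0 ≤ blockEntropy f n :=
  Finset.sum_nonneg fun w _ => Real.negMulLog_nonneg (hf.nonneg n w) (hf.le_one n w)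

lemma sum_mul_wsuffix {n F : ℕ} (h : F ≤ n) (φ : (Fin F → A) → ℝ) :
    ∑ w, f n w * φ (wsuffix h w) = ∑ u, f F u * φ u := by
  induction n, h using Nat.le_induction with
  | base => simp only [wsuffix_self]
  | succ n h ih =>
    rw [sum_wcons, ← ih]
    refine Finset.sum_congr rfl fun w _ => ?_
    rw [← hf.sum_cons n w, Finset.sum_mul]
    exact Finset.sum_congr rfl fun a _ => by rw [wsuffix_wcons h]

lemma blockEntropy_add_two_add_le (n : ℕ) :
    blockEntropy f (n + 2) + blockEntropy f n ≤
      blockEntropy f (n + 1) + blockEntropy f (n + 1) := by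
  let p : (Fin n → A) × A × A → ℝ := fun z => f (n + 2) (wcons z.2.1 (wsnoc z.1 z.2.2))
  let q : (Fin n → A) × A × A → ℝ := fun z =>
    f (n + 1) (wcons z.2.1 z.1) * f (n + 1) (wsnoc z.1 z.2.2) / f n z.1
  have hp_snoc : ∀ z, p z ≤ f (n + 1) (wsnoc z.1 z.2.2) := fun z => hf.wcons_le _ _
  have hp_cons : ∀ z, p z ≤ f (n + 1) (wcons z.2.1 z.1) := fun z => by
    simp only [p, wcons_wsnoc]
    exact hf.wsnoc_le _ _
  have hp0 : ∀ z, 0 ≤ p z := fun z => hf.nonneg _ _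
  have hq0 : ∀ z, 0 ≤ q z := fun z =>
    div_nonneg (mul_nonneg (hf.nonneg _ _) (hf.nonneg _ _)) (hf.nonneg _ _)
  have hpn : ∀ z, p z ≤ f n z.1 := fun z => (hp_snoc z).trans (hf.wsnoc_le _ _)
  have hac : ∀ z, q z = 0 → p z = 0 := by
    intro z hz
    simp only [q, div_eq_zero_iff, mul_eq_zero] at hz
    refine le_antisymm ?_ (hp0 z)
    rcases hz with (h | h) | h
    · exact h ▸ hp_cons z
    · exact h ▸ hp_snoc z
    · exact h ▸ hpn z
  have hp1 : ∑ z, p z = 1 := by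
    rw [← hf.sum_eq_one n, Fintype.sum_prod_type]
    refine Finset.sum_congr rfl fun w _ => ?_
    rw [Fintype.sum_prod_type, Finset.sum_comm]
    simp only [p, hf.sum_cons, hf.sum_snoc]
  have hq1 : ∑ z, q z = 1 := by
    rw [← hf.sum_eq_one n, Fintype.sum_prod_type]
    refine Finset.sum_congr rfl fun w _ => ?_
    rw [Fintype.sum_prod_type]
    simp only [q, ← Finset.sum_div, ← Finset.mul_sum, ← Finset.sum_mul, hf.sum_cons, hf.sum_snoc]
    exact mul_self_div_self _
  have hlog : ∀ z, p z * (Real.log (p z) - Real.log (q z)) =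
      -Real.negMulLog (p z) + p z * Real.log (f n z.1)
        - p z * Real.log (f (n + 1) (wcons z.2.1 z.1))
        - p z * Real.log (f (n + 1) (wsnoc z.1 z.2.2)) := by
    intro z
    rcases (hp0 z).eq_or_lt with h | h
    · simp [← h]
    · rw [Real.log_div (mul_pos (h.trans_le (hp_cons z)) (h.trans_le (hp_snoc z))).ne'
        (h.trans_le (hpn z)).ne', Real.log_mul (h.trans_le (hp_cons z)).ne'
        (h.trans_le (hp_snoc z)).ne', Real.negMulLog]
      ring
  have key := sum_sub_sum_le_sum_mul_log_sub_log hp0 hq0 hac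
  simp only [hp1, hq1, sub_self, hlog, Finset.sum_sub_distrib, Finset.sum_add_distrib,
    Finset.sum_neg_distrib] at key
  have e2 : ∑ z, Real.negMulLog (p z) = blockEntropy f (n + 2) := by
    rw [blockEntropy, sum_wcons, sum_wsnoc, Fintype.sum_prod_type]
    refine Finset.sum_congr rfl fun w _ => ?_
    rw [Fintype.sum_prod_type, Finset.sum_comm]
  have e0 : ∑ z, p z * Real.log (f n z.1) = -blockEntropy f n := by
    rw [blockEntropy, Fintype.sum_prod_type, ← Finset.sum_neg_distrib]
    refine Finset.sum_congr rfl fun w _ => ?_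
    rw [Fintype.sum_prod_type, Finset.sum_comm]
    simp only [p, ← Finset.sum_mul, hf.sum_cons, hf.sum_snoc, Real.negMulLog]
    ring
  have e1 : ∑ z, p z * Real.log (f (n + 1) (wcons z.2.1 z.1)) = -blockEntropy f (n + 1) := by
    rw [blockEntropy, sum_wcons, Fintype.sum_prod_type, ← Finset.sum_neg_distrib]
    refine Finset.sum_congr rfl fun w _ => ?_
    rw [Fintype.sum_prod_type, ← Finset.sum_neg_distrib]
    simp only [p, ← Finset.sum_mul, wcons_wsnoc, hf.sum_snoc, Real.negMulLog]
    exact Finset.sum_congr rfl fun w _ => by ring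
  have e1' : ∑ z, p z * Real.log (f (n + 1) (wsnoc z.1 z.2.2)) = -blockEntropy f (n + 1) := by
    rw [blockEntropy, sum_wsnoc, Fintype.sum_prod_type, ← Finset.sum_neg_distrib]
    refine Finset.sum_congr rfl fun w _ => ?_
    rw [Fintype.sum_prod_type, Finset.sum_comm, ← Finset.sum_neg_distrib]
    simp only [p, ← Finset.sum_mul, hf.sum_cons, Real.negMulLog]
    exact Finset.sum_congr rfl fun w _ => by ring
  rw [e2, e0, e1, e1'] at key
  linarith

/-- The entropy rate is at most every conditional entropy. -/
lemma limsup_blockEntropy_div_le (n : ℕ) :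
    Filter.limsup (fun m : ℕ => blockEntropy f m / m) Filter.atTop ≤
      blockEntropy f (n + 1) - blockEntropy f n := by
  set a := blockEntropy f (n + 1) - blockEntropy f n with ha
  have hanti : ∀ m, n ≤ m → blockEntropy f (m + 1) - blockEntropy f m ≤ a := by
    intro m hm
    induction m, hm using Nat.le_induction with
    | base => exact le_rfl
    | succ m hm ih =>
      have := hf.blockEntropy_add_two_add_le m
      linarith
  have hlin : ∀ m, n ≤ m → blockEntropy f m ≤ blockEntropy f n + (m - n) * a := by
    intro m hm
    induction m, hm using Nat.le_induction with
    | base => simp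
    | succ m hm ih =>
      have := hanti m hm
      push_cast
      linarith
  have hlim : Tendsto (fun m : ℕ => (blockEntropy f n - n * a) / m + a) atTop (𝓝 a) := by
    simpa using (tendsto_const_div_atTop_nhds_zero_nat (blockEntropy f n - n * a)).add_const a
  rw [← hlim.limsup_eq]
  refine limsup_le_limsup ?_ ?_ hlim.isBoundedUnder_le
  · filter_upwards [eventually_ge_atTop n, eventually_gt_atTop 0] with m hm hm0
    have hm0' : (0 : ℝ) < m := by exact_mod_cast hm0
    rw [div_add' _ _ _ hm0'.ne']
    gcongr
    linarith [hlin m hm]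
  · exact IsBoundedUnder.isCoboundedUnder_le
      ⟨0, eventually_map.2 (Eventually.of_forall fun m =>
        div_nonneg (hf.blockEntropy_nonneg m) m.cast_nonneg)⟩

omit hf in
/-- The Markov kernel attached to an eigenfunction `r` of the transfer operator of an edge set. -/
noncomputable def _root_.eigenKernel {F : ℕ} (E : (Fin F → A) → A → Prop)
    [∀ u a, Decidable (E u a)] (r : (Fin F → A) → ℝ) (lam : ℝ) (u : Fin F → A) (a : A) : ℝ :=
  if E u a then r (Fin.tail (wsnoc u a)) / (lam * r u) else 0

variable {F : ℕ} {E : (Fin F → A) → A → Prop} [∀ u a, Decidable (E u a)]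
  {r : (Fin F → A) → ℝ} {lam : ℝ}

omit [Fintype A] hf in
lemma _root_.eigenKernel_nonneg (hlam : 0 < lam)
    (hr : ∀ u a, E u a → 0 < r u ∧ 0 < r (Fin.tail (wsnoc u a))) (u : Fin F → A) (a : A) :
    0 ≤ eigenKernel E r lam u a := by
  unfold eigenKernel
  split_ifs with h
  · exact div_nonneg (hr u a h).2.le (mul_nonneg hlam.le (hr u a h).1.le)
  · exact le_rfl

omit hf in
lemma _root_.sum_eigenKernel (hlam : 0 < lam)
    (heig : ∀ u, ∑ a, (if E u a then r (Fin.tail (wsnoc u a)) else 0) = lam * r u)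
    {u : Fin F → A} (hu : 0 < r u) : ∑ a, eigenKernel E r lam u a = 1 := by
  rw [← div_self (mul_pos hlam hu).ne']
  nth_rewrite 1 [← heig u]
  rw [Finset.sum_div]
  refine Finset.sum_congr rfl fun a _ => ?_
  unfold eigenKernel
  split_ifs <;> simp

/-- Almost maximal entropy forces the process to be almost Markov, with the kernel of maximal
entropy as its transition kernel. -/
lemma sum_abs_sub_mul_eigenKernel_le (hlam : 0 < lam)
    (hr : ∀ u a, E u a → 0 < r u ∧ 0 < r (Fin.tail (wsnoc u a)))
    (heig : ∀ u, ∑ a, (if E u a then r (Fin.tail (wsnoc u a)) else 0) = lam * r u)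
    {n : ℕ} (h : F ≤ n)
    (hsupp : ∀ (w : Fin n → A) a, f (n + 1) (wsnoc w a) ≠ 0 → E (wsuffix h w) a)
    {δ : ℝ} (hδ : Real.log lam - δ ≤ blockEntropy f (n + 1) - blockEntropy f n) :
    ∑ w : Fin n → A, ∑ a,
      |f (n + 1) (wsnoc w a) - f n w * eigenKernel E r lam (wsuffix h w) a| ≤ 2 * √δ := by
  rw [← Fintype.sum_prod_type' (f := fun (w : Fin n → A) a =>
    |f (n + 1) (wsnoc w a) - f n w * eigenKernel E r lam (wsuffix h w) a|)]
  let p : (Fin n → A) × A → ℝ := fun z => f (n + 1) (wsnoc z.1 z.2)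
  let q : (Fin n → A) × A → ℝ := fun z =>
    f n z.1 * eigenKernel E r lam (wsuffix h z.1) z.2
  have hp0 : ∀ z, 0 ≤ p z := fun z => hf.nonneg _ _
  have hpn : ∀ z, p z ≤ f n z.1 := fun z => hf.wsnoc_le _ _
  have hpE : ∀ z, 0 < p z → E (wsuffix h z.1) z.2 := fun z hz => hsupp _ _ hz.ne'
  have hK : ∀ z, 0 < p z → 0 < eigenKernel E r lam (wsuffix h z.1) z.2 := by
    intro z hz
    have hE := hpE z hz
    rw [eigenKernel, if_pos hE]
    exact div_pos (hr _ _ hE).2 (mul_pos hlam (hr _ _ hE).1)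
  have hp1 : ∑ z, p z = 1 := by
    rw [Fintype.sum_prod_type, ← hf.sum_eq_one n]
    exact Finset.sum_congr rfl fun w _ => hf.sum_snoc n w
  refine sum_abs_sub_le_two_mul_sqrt (p := p) (q := q) hp0
    (fun z => mul_nonneg (hf.nonneg _ _) (eigenKernel_nonneg hlam hr _ _)) ?_ hp1 ?_ ?_
  · intro z hz
    by_contra hne
    have hpos := lt_of_le_of_ne (hp0 z) (Ne.symm hne)
    exact (mul_pos (hpos.trans_le (hpn z)) (hK z hpos)).ne' hz
  · rw [Fintype.sum_prod_type, ← hf.sum_eq_one n]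
    refine Finset.sum_congr rfl fun w _ => ?_
    simp only [q, ← Finset.mul_sum]
    rcases (hf.nonneg n w).eq_or_lt with h0 | h0
    · rw [← h0, zero_mul]
    · rw [← hf.sum_snoc] at h0
      obtain ⟨a, -, ha⟩ := Finset.exists_ne_zero_of_sum_ne_zero h0.ne'
      rw [sum_eigenKernel hlam heig (hr _ _ (hsupp w a ha)).1, mul_one]
  · have hlog : ∀ z, p z * (Real.log (p z) - Real.log (q z)) =
        -Real.negMulLog (p z) - p z * Real.log (f n z.1) + p z * Real.log lam
          + p z * Real.log (r (wsuffix h z.1))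
          - p z * Real.log (r (wsuffix (h.trans n.le_succ) (wsnoc z.1 z.2))) := by
      intro z
      rcases (hp0 z).eq_or_lt with h0 | h0
      · simp [← h0]
      · have hE := hpE z h0
        have hrz := hr _ _ hE
        simp only [q]
        rw [wsuffix_wsnoc h, Real.log_mul (h0.trans_le (hpn z)).ne' (hK z h0).ne',
          eigenKernel, if_pos hE, Real.log_div hrz.2.ne' (mul_pos hlam hrz.1).ne',
          Real.log_mul hlam.ne' hrz.1.ne', Real.negMulLog]
        ring
    have e1 : ∑ z, Real.negMulLog (p z) = blockEntropy f (n + 1) := by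
      rw [blockEntropy, sum_wsnoc, Fintype.sum_prod_type]
    have e0 : ∑ z, p z * Real.log (f n z.1) = -blockEntropy f n := by
      rw [blockEntropy, Fintype.sum_prod_type, ← Finset.sum_neg_distrib]
      refine Finset.sum_congr rfl fun w _ => ?_
      simp only [p, ← Finset.sum_mul, hf.sum_snoc, Real.negMulLog]
      ring
    have e2 : ∑ z, p z * Real.log (r (wsuffix h z.1)) = ∑ u, f F u * Real.log (r u) := by
      rw [← hf.sum_mul_wsuffix h fun u => Real.log (r u), Fintype.sum_prod_type]
      refine Finset.sum_congr rfl fun w _ => ?_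
      simp only [p, ← Finset.sum_mul, hf.sum_snoc]
    have e3 : ∑ z, p z * Real.log (r (wsuffix (h.trans n.le_succ) (wsnoc z.1 z.2))) =
        ∑ u, f F u * Real.log (r u) := by
      rw [← hf.sum_mul_wsuffix (h.trans n.le_succ) fun u => Real.log (r u), sum_wsnoc,
        Fintype.sum_prod_type]
    simp only [hlog, Finset.sum_sub_distrib, Finset.sum_add_distrib, Finset.sum_neg_distrib,
      ← Finset.sum_mul, hp1, e1, e0, e2, e3]
    linarith

end IsStationaryFamily

end Words

lemma mulVec_pow_eq {V : Type*} [Fintype V] [DecidableEq V] {M : Matrix V V ℝ} {r : V → ℝ}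
    {lam : ℝ} (h : M.mulVec r = lam • r) (t : ℕ) : (M ^ t).mulVec r = lam ^ t • r := by
  induction t with
  | zero => simp
  | succ t ih => rw [pow_succ, ← Matrix.mulVec_mulVec, h, Matrix.mulVec_smul, ih, smul_smul,
      pow_succ, mul_comm]

/-- Powers of the stochastic matrix obtained from `M` by normalizing with an eigenvector. -/
lemma pow_apply_eq_of_apply_eq {V : Type*} [Fintype V] [DecidableEq V] {M P : Matrix V V ℝ}
    {r : V → ℝ} (hr : ∀ v, 0 < r v) {lam : ℝ}
    (hP : ∀ u v, P u v = M u v * (r v / (lam * r u))) (t : ℕ) (u v : V) :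
    (P ^ t) u v = (M ^ t) u v * (r v / (lam ^ t * r u)) := by
  induction t generalizing v with
  | zero =>
    by_cases huv : u = v
    · subst huv
      simp [(hr u).ne']
    · simp [huv]
  | succ t ih =>
    simp only [pow_succ, Matrix.mul_apply, ih, hP, Finset.sum_mul]
    refine Finset.sum_congr rfl fun w _ => ?_
    have hw := (hr w).ne'
    rw [mul_mul_mul_comm, div_mul_div_comm]
    congr 1
    rw [show r w * r v = r v * r w by ring,
      show lam ^ t * r u * (lam * r w) = lam ^ t * lam * r u * r w by ring,
      mul_div_mul_right _ _ hw]

lemma exists_inv_le_pow_apply {V : Type*} [Fintype V] [DecidableEq V] {M P : Matrix V V ℝ}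
    (hM : ∀ t u v, 0 ≤ (M ^ t) u v) {r : V → ℝ} (hr : ∀ v, 0 < r v) {lam : ℝ} (hlam : 0 < lam)
    (heig : M.mulVec r = lam • r) (hP : ∀ u v, P u v = M u v * (r v / (lam * r u)))
    (hpath : ∀ u v, ∃ t < Fintype.card V, 1 ≤ (M ^ t) u v) {C : ℝ}
    (hC : ∀ t < Fintype.card V, lam ^ t ≤ C) (u v : V) :
    ∃ t < Fintype.card V, (C ^ 2)⁻¹ ≤ (P ^ t) u v := by
  obtain ⟨t, ht, h1⟩ := hpath u v
  obtain ⟨t', ht', h2⟩ := hpath v u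
  refine ⟨t, ht, ?_⟩
  have h3 : r u ≤ lam ^ t' * r v := by
    have := congrFun (mulVec_pow_eq heig t') v
    simp only [Pi.smul_apply, smul_eq_mul] at this
    rw [← this]
    calc r u ≤ (M ^ t') v u * r u := le_mul_of_one_le_left (hr u).le h2
      _ ≤ _ := Finset.single_le_sum (f := fun w => (M ^ t') v w * r w)
        (fun w _ => mul_nonneg (hM t' v w) (hr w).le) (Finset.mem_univ u)
  have hlt := pow_pos hlam t
  have hlt' := pow_pos hlam t'
  rw [pow_apply_eq_of_apply_eq hr hP]
  refine le_trans ?_ (le_mul_of_one_le_left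
    (div_pos (hr v) (mul_pos hlt (hr u))).le h1)
  have hCpos : 0 < C := hlt.trans_le (hC t ht)
  rw [inv_le_comm₀ (by positivity) (div_pos (hr v) (mul_pos hlt (hr u))), inv_div,
    div_le_iff₀ (hr v), sq]
  calc lam ^ t * r u ≤ lam ^ t * (lam ^ t' * r v) := by gcongr
    _ = lam ^ t * lam ^ t' * r v := by ring
    _ ≤ C * C * r v := by
      have := (hr v).le
      gcongr
      · exact hC t ht
      · exact hC t' ht'

section Comparison

variable {A : Type*} [Fintype A]

/-- The stochastic matrix on `F`-words obtained by appending a letter with law `K u` to `u` and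
dropping the first letter. -/
noncomputable def wordMatrix {F : ℕ} [DecidableEq A] (K : (Fin F → A) → A → ℝ)
    (p : (Fin F → A) → Prop) : Matrix {u // p u} {u // p u} ℝ :=
  fun u v => ∑ a, if Fin.tail (wsnoc u.1 a) = v.1 then K u.1 a else 0

namespace IsStationaryFamily

variable {f g : ∀ n, (Fin n → A) → ℝ} (hf : IsStationaryFamily f) (hg : IsStationaryFamily g)
  {F : ℕ} {K : (Fin F → A) → A → ℝ}

include hf hg in
lemma sum_abs_sub_le_succ (n : ℕ) :
    ∑ w, |f n w - g n w| ≤ ∑ w, |f (n + 1) w - g (n + 1) w| := by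
  rw [sum_wsnoc]
  refine Finset.sum_le_sum fun w _ => ?_
  rw [← hf.sum_snoc, ← hg.sum_snoc, ← Finset.sum_sub_distrib]
  exact Finset.abs_sum_le_sum_abs _ _

lemma sum_abs_sub_succ_le (hK0 : ∀ u a, 0 ≤ K u a) (hK1 : ∀ u, ∑ a, K u a ≤ 1)
    {n : ℕ} (h : F ≤ n) {η η' : ℝ}
    (hfK : ∑ w : Fin n → A, ∑ a,
      |f (n + 1) (wsnoc w a) - f n w * K (wsuffix h w) a| ≤ η)
    (hgK : ∑ w : Fin n → A, ∑ a,
      |g (n + 1) (wsnoc w a) - g n w * K (wsuffix h w) a| ≤ η') :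
    ∑ w, |f (n + 1) w - g (n + 1) w| ≤ ∑ w, |f n w - g n w| + (η + η') := by
  rw [sum_wsnoc]
  calc ∑ w : Fin n → A, ∑ a, |f (n + 1) (wsnoc w a) - g (n + 1) (wsnoc w a)|
      ≤ ∑ w : Fin n → A, ∑ a, (|f n w - g n w| * K (wsuffix h w) a +
          (|f (n + 1) (wsnoc w a) - f n w * K (wsuffix h w) a| +
            |g (n + 1) (wsnoc w a) - g n w * K (wsuffix h w) a|)) := by
        refine Finset.sum_le_sum fun w _ => Finset.sum_le_sum fun a _ => ?_
        rw [← abs_of_nonneg (hK0 (wsuffix h w) a), ← abs_mul, abs_of_nonneg (hK0 _ _),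
          abs_sub_comm (g (n + 1) _)]
        refine le_trans ?_ ((add_le_add_right (abs_add_le _ _) _).trans' (abs_add_le _ _))
        apply le_of_eq
        congr 1
        ring
    _ ≤ _ := by
        simp only [Finset.sum_add_distrib, ← Finset.mul_sum]
        refine add_le_add (Finset.sum_le_sum fun w _ => ?_) (add_le_add hfK hgK)
        exact mul_le_of_le_one_right (abs_nonneg _) (hK1 _)

include hf in
lemma sum_tail_eq [DecidableEq A] (v : Fin F → A) :
    ∑ u : Fin F → A, ∑ a,
      (if Fin.tail (wsnoc u a) = v then f (F + 1) (wsnoc u a) else 0) = f F v := by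
  rw [← sum_wsnoc (fun w => if Fin.tail w = v then f (F + 1) w else 0), sum_wcons]
  rw [Finset.sum_eq_single v]
  · simp only [wcons, Fin.tail_cons, if_true]
    exact hf.sum_cons F v
  · intro w _ hw
    simp [wcons, hw]
  · simp

include hf hg in
/-- Two stationary processes that are almost Markov with the same irreducible kernel have almost
the same distribution on the states. -/
lemma mul_sum_abs_sub_le [DecidableEq A] {p : (Fin F → A) → Prop} [DecidablePred p]
    (hfp : ∀ u, ¬ p u → f F u = 0) (hgp : ∀ u, ¬ p u → g F u = 0)
    (hK0 : ∀ u a, 0 ≤ K u a) (hK1 : ∀ u, p u → ∑ a, K u a = 1)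
    (hKp : ∀ u a, K u a ≠ 0 → p (Fin.tail (wsnoc u a))) {c : ℝ}
    (hc : ∀ u v, ∃ t < Fintype.card {u // p u}, c ≤ ((wordMatrix K p) ^ t) u v) {η η' : ℝ}
    (hfK : ∑ u : Fin F → A, ∑ a, |f (F + 1) (wsnoc u a) - f F u * K u a| ≤ η)
    (hgK : ∑ u : Fin F → A, ∑ a, |g (F + 1) (wsnoc u a) - g F u * K u a| ≤ η') :
    c * ∑ u, |f F u - g F u| ≤ Fintype.card {u // p u} * (η + η') := by
  have hsub : ∀ φ : (Fin F → A) → ℝ, (∀ u, ¬ p u → φ u = 0) →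
      ∑ u : {u // p u}, φ u.1 = ∑ u, φ u := by
    intro φ hφ
    rw [← Finset.sum_subtype (Finset.univ.filter p) (by simp) φ, Finset.sum_filter]
    refine Finset.sum_congr rfl fun u _ => ?_
    split_ifs with h
    · rfl
    · exact (hφ u h).symm
  have hstoch : ∀ u : {u // p u}, ∑ v, wordMatrix K p u v = 1 := by
    intro u
    simp only [wordMatrix]
    rw [Finset.sum_comm, ← hK1 u.1 u.2]
    refine Finset.sum_congr rfl fun a _ => ?_
    rw [hsub fun v => if Fin.tail (wsnoc u.1 a) = v then K u.1 a else 0]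
    · simp
    · intro v hv
      split_ifs with h
      · by_contra hne
        exact hv (h ▸ hKp _ _ hne)
      · rfl
  have hfg : ∀ u, ¬ p u → f F u - g F u = 0 := fun u hu => by rw [hfp u hu, hgp u hu, sub_zero]
  rw [← hsub (fun u => |f F u - g F u|) fun u hu => by rw [hfg u hu, abs_zero]]
  refine mul_sum_abs_le_of_sum_abs_sub_vecMul_le
    (P := wordMatrix K p) (d := fun u => f F u.1 - g F u.1) ?_ hstoch hc ?_ ?_
  · intro u v
    exact Finset.sum_nonneg fun a _ => by split_ifs <;> simp [hK0]
  · rw [hsub (fun u => f F u - g F u) hfg, Finset.sum_sub_distrib, hf.sum_eq_one,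
      hg.sum_eq_one, sub_self]
  · have hvec : ∀ v : {u // p u},
        (Matrix.vecMul (fun u : {u // p u} => f F u.1 - g F u.1) (wordMatrix K p)) v =
          ∑ u, ∑ a, if Fin.tail (wsnoc u a) = v.1 then (f F u - g F u) * K u a else 0 := by
      intro v
      rw [← hsub]
      · simp only [Matrix.vecMul, dotProduct, wordMatrix, Finset.mul_sum, mul_ite, mul_zero]
      · intro u hu
        simp [hfg u hu]
    have hle : ∀ v : {u // p u},
        |f F v.1 - g F v.1 -
          (Matrix.vecMul (fun u : {u // p u} => f F u.1 - g F u.1) (wordMatrix K p)) v| ≤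
        ∑ u, ∑ a, if Fin.tail (wsnoc u a) = v.1 then
          (|f (F + 1) (wsnoc u a) - f F u * K u a| +
            |g (F + 1) (wsnoc u a) - g F u * K u a|) else 0 := by
      intro v
      rw [hvec, ← hf.sum_tail_eq v.1, ← hg.sum_tail_eq v.1, ← Finset.sum_sub_distrib,
        ← Finset.sum_sub_distrib]
      refine (Finset.abs_sum_le_sum_abs _ _).trans (Finset.sum_le_sum fun u _ => ?_)
      rw [← Finset.sum_sub_distrib, ← Finset.sum_sub_distrib]
      refine (Finset.abs_sum_le_sum_abs _ _).trans (Finset.sum_le_sum fun a _ => ?_)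
      split_ifs with h
      · rw [abs_sub_comm (g (F + 1) _)]
        refine le_trans (le_of_eq ?_) (abs_add_le _ _)
        congr 1
        ring
      · simp
    refine (Finset.sum_le_sum fun v _ => hle v).trans ?_
    rw [Finset.sum_comm]
    refine le_trans (Finset.sum_le_sum fun u _ => ?_) ((Finset.sum_add_distrib.trans_le
      (add_le_add hfK hgK)))
    rw [Finset.sum_comm, ← Finset.sum_add_distrib]
    refine Finset.sum_le_sum fun a _ => ?_
    set x := |f (F + 1) (wsnoc u a) - f F u * K u a| + |g (F + 1) (wsnoc u a) - g F u * K u a|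
    have hx : 0 ≤ x := by positivity
    by_cases h : p (Fin.tail (wsnoc u a))
    · rw [Finset.sum_eq_single ⟨_, h⟩]
      · simp
      · intro v _ hv
        rw [if_neg fun h' => hv (Subtype.ext h'.symm)]
      · simp
    · refine (Finset.sum_eq_zero fun v _ => ?_).trans_le hx
      rw [if_neg fun h' : Fin.tail (wsnoc u a) = v.1 => h (h' ▸ v.2)]

end IsStationaryFamily

end Comparison

/-- `w` is a word of the language of `X`. -/
def Adm {A : Type*} (X : Set (ℤ → A)) {n : ℕ} (w : Fin n → A) : Prop :=
  ∃ x ∈ X, ∀ j : Fin n, x ((j : ℕ) : ℤ) = w j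

section Language

variable {A : Type*} {X : Set (ℤ → A)} {F : ℕ}

lemma occursAt_zero_ofFn {n : ℕ} (x : ℤ → A) (w : Fin n → A) :
    occursAt x 0 (List.ofFn w) ↔ ∀ j : Fin n, x ((j : ℕ) : ℤ) = w j := by
  constructor
  · intro h j
    simpa using h (Fin.cast (by simp) j)
  · intro h j
    simpa using h ⟨j, by simpa using j.2⟩

lemma inLang_ofFn {n : ℕ} (w : Fin n → A) : inLang X (List.ofFn w) ↔ Adm X w := by
  simp only [inLang, Adm, occursAt_zero_ofFn]

lemma card_inLang (X : Set (ℤ → A)) (n : ℕ) :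
    Nat.card {w : List A // w.length = n ∧ inLang X w} =
      Nat.card {w : Fin n → A // Adm X w} := by
  refine (Nat.card_congr (Equiv.ofBijective
    (fun w : {w : Fin n → A // Adm X w} =>
      (⟨List.ofFn w.1, List.length_ofFn, (inLang_ofFn _).2 w.2⟩ :
        {w : List A // w.length = n ∧ inLang X w})) ⟨?_, ?_⟩)).symm
  · intro v w h
    exact Subtype.ext (List.ofFn_injective (Subtype.ext_iff.1 h))
  · rintro ⟨l, rfl, hl⟩
    exact ⟨⟨l.get, (inLang_ofFn _).1 (by rwa [List.ofFn_get])⟩, Subtype.ext (List.ofFn_get l)⟩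

lemma shift_mem_of_sftCover_eq (hF : sftCover X F = X) {x : ℤ → A} (hx : x ∈ X) (k : ℤ) :
    (fun i => x (k + i)) ∈ X := by
  rw [← hF] at hx ⊢
  intro i w hw hocc
  refine hx (k + i) w hw fun j => ?_
  rw [← hocc j, add_assoc]

lemma adm_window (hF : sftCover X F = X) {x : ℤ → A} (hx : x ∈ X) (k : ℤ) (n : ℕ) :
    Adm X (fun j : Fin n => x (k + (j : ℕ))) :=
  ⟨_, shift_mem_of_sftCover_eq hF hx k, fun _ => rfl⟩

lemma wsnoc_window (x : ℤ → A) (k : ℤ) (n : ℕ) :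
    wsnoc (fun j : Fin n => x (k + (j : ℕ))) (x (k + n)) =
      fun j : Fin (n + 1) => x (k + (j : ℕ)) := by
  ext j
  rw [wsnoc_apply]
  split_ifs with h
  · rfl
  · rw [show (j : ℕ) = n by omega]

lemma tail_window (x : ℤ → A) (k : ℤ) (n : ℕ) :
    Fin.tail (fun j : Fin (n + 1) => x (k + (j : ℕ))) =
      fun j : Fin n => x (k + 1 + (j : ℕ)) := by
  ext j
  simp only [Fin.tail, Fin.val_succ]
  congr 1
  push_cast
  ring

lemma Adm.of_wsnoc {n : ℕ} {w : Fin n → A} {a : A} (h : Adm X (wsnoc w a)) : Adm X w := by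
  obtain ⟨x, hx, h⟩ := h
  refine ⟨x, hx, fun j => ?_⟩
  simpa using h j.castSucc

lemma Adm.tail (hF : sftCover X F = X) {n : ℕ} {w : Fin (n + 1) → A} (h : Adm X w) :
    Adm X (Fin.tail w) := by
  obtain ⟨x, hx, h⟩ := h
  have : w = fun j : Fin (n + 1) => x (0 + (j : ℕ)) := by
    ext j
    simp [h]
  rw [this, tail_window]
  exact adm_window hF hx _ _

lemma Adm.suffix_wsnoc (hF : sftCover X F = X) {n m : ℕ} (hn : m ≤ n) {w : Fin n → A} {a : A}
    (h : Adm X (wsnoc w a)) : Adm X (wsnoc (wsuffix hn w) a) := by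
  obtain ⟨x, hx, h⟩ := h
  convert adm_window hF hx ((n - m : ℕ) : ℤ) (m + 1) using 1
  ext j
  have hj := h ⟨n - m + j, by omega⟩
  push_cast at hj
  rw [wsnoc_apply] at hj ⊢
  rw [hj]
  by_cases hjm : (j : ℕ) < m
  · rw [dif_pos hjm, dif_pos (by simp only; omega)]
    rfl
  · rw [dif_neg hjm, dif_neg (by simp only; omega)]

lemma Adm.wsnoc_of_suffix (hF : sftCover X F = X) {n : ℕ} (hn : F ≤ n) {w : Fin n → A} {a : A}
    (hw : Adm X w) (h : Adm X (wsnoc (wsuffix hn w) a)) : Adm X (wsnoc w a) := by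
  obtain ⟨x, hx, hxw⟩ := hw
  obtain ⟨y, hy, hyw⟩ := h
  set z : ℤ → A := fun i => if i < n then x i else y (i - (n - F)) with hz
  have hzy : ∀ i : ℤ, (n : ℤ) - F ≤ i → z i = y (i - (n - F)) := by
    intro i hi
    by_cases hin : i < n
    · simp only [hz, if_pos hin]
      obtain ⟨j, hj⟩ := Int.eq_ofNat_of_zero_le (sub_nonneg.2 hi)
      have hjF : j < F := by omega
      have h1 := hyw ⟨j, by omega⟩
      have h2 := hxw ⟨n - F + j, by omega⟩
      rw [wsnoc_apply, dif_pos hjF] at h1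
      rw [hj]
      refine Eq.trans ?_ h1.symm
      refine Eq.trans ?_ h2
      congr 1
      push_cast
      omega
    · simp only [hz, if_neg hin]
  refine ⟨z, ?_, fun j => ?_⟩
  · rw [← hF]
    intro i v hv hocc
    by_cases hi : i + v.length ≤ n
    · rw [← hF] at hx
      refine hx i v hv fun j => ?_
      rw [← hocc j]
      simp only [hz]
      rw [if_pos]
      have := j.2
      omega
    · rw [← hF] at hy
      refine hy (i - (n - F)) v hv fun j => ?_
      rw [← hocc j, hzy _ (by omega)]
      congr 1
      ring
  · rw [wsnoc_apply]
    by_cases hj : (j : ℕ) < n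
    · rw [dif_pos hj]
      simp only [hz]
      rw [if_pos (by exact_mod_cast hj)]
      exact hxw ⟨j, hj⟩
    · have hjn : (j : ℕ) = n := by omega
      have h1 := hyw (Fin.last F)
      rw [wsnoc_apply, dif_neg (by simp)] at h1
      rw [dif_neg hj, hjn, hzy _ (by omega), ← h1]
      congr 1
      simp

/-- One letter extends `u` to `v` after dropping the first letter of `u`. -/
def WordEdge (X : Set (ℤ → A)) {F : ℕ} (u v : {u : Fin F → A // Adm X u}) : Prop :=
  ∃ a, Adm X (wsnoc u.1 a) ∧ Fin.tail (wsnoc u.1 a) = v.1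

lemma reflTransGen_wordEdge (hF : sftCover X F = X) (hmix : TopMixing X)
    (u v : {u : Fin F → A // Adm X u}) : Relation.ReflTransGen (WordEdge X) u v := by
  obtain ⟨N, hN⟩ := hmix (List.ofFn u.1) (List.ofFn v.1)
    ((inLang_ofFn _).2 u.2) ((inLang_ofFn _).2 v.2)
  obtain ⟨w, -, x, hx, hocc⟩ := hN N le_rfl
  have hpath : ∀ k : ℕ, Relation.ReflTransGen (WordEdge X) u
      ⟨fun j : Fin F => x ((k : ℤ) + (j : ℕ)), adm_window hF hx k F⟩ := by
    intro k
    induction k with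
    | zero =>
      have : u = ⟨fun j : Fin F => x (((0 : ℕ) : ℤ) + (j : ℕ)), adm_window hF hx _ F⟩ := by
        ext j
        have := hocc ⟨j, by simp; omega⟩
        simp only [List.get_eq_getElem] at this
        rw [List.getElem_append_left (by simp; omega), List.getElem_append_left (by simp)] at this
        simpa using this.symm
      rw [← this]
    | succ k ih =>
      refine ih.tail ⟨x ((k : ℤ) + F), ?_, ?_⟩
      · rw [wsnoc_window]
        exact adm_window hF hx _ _
      · rw [wsnoc_window, tail_window]
        push_cast
        rfl
  have hv : v = ⟨fun j : Fin F => x (((F + w.length : ℕ) : ℤ) + (j : ℕ)),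
      adm_window hF hx _ F⟩ := by
    ext j
    have := hocc ⟨F + w.length + j, by simp; omega⟩
    simp only [List.get_eq_getElem] at this
    rw [List.getElem_append_right (by simp)] at this
    simpa [← add_assoc] using this.symm
  rw [hv]
  exact hpath _

lemma Adm.exists_wsnoc {n : ℕ} {w : Fin n → A} (h : Adm X w) : ∃ a, Adm X (wsnoc w a) := by
  obtain ⟨x, hx, h⟩ := h
  refine ⟨x n, x, hx, fun j => ?_⟩
  rw [wsnoc_apply]
  split_ifs with hj
  · exact h ⟨j, hj⟩
  · rw [show (j : ℕ) = n by omega]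

open Classical in
/-- Perron eigendata of a strongly connected shift of finite type. -/
lemma exists_eigenData [Fintype A] (hX : X.Nonempty) (hF : sftCover X F = X)
    (hmix : TopMixing X) :
    ∃ (lam : ℝ) (r : (Fin F → A) → ℝ), 0 < lam ∧ (∀ u, Adm X u → 0 < r u) ∧
      (∀ u, ¬ Adm X u → r u = 0) ∧
      (∀ u, ∑ a, (if Adm X (wsnoc u a) then r (Fin.tail (wsnoc u a)) else 0) = lam * r u) ∧
      ∀ u v, ∃ t < Fintype.card {u : Fin F → A // Adm X u},
        ((((Fintype.card {u : Fin F → A // Adm X u} : ℝ) ^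
          (Fintype.card {u : Fin F → A // Adm X u} - 1)) ^ 2)⁻¹) ≤
        ((wordMatrix (eigenKernel (fun u a => Adm X (wsnoc u a)) r lam) (Adm X)) ^ t) u v := by
  let V := {u : Fin F → A // Adm X u}
  obtain ⟨x, hx⟩ := hX
  have : Nonempty V := ⟨⟨_, adm_window hF hx 0 F⟩⟩
  let M : Matrix V V ℝ := fun u v =>
    ∑ a, if Adm X (wsnoc u.1 a) ∧ Fin.tail (wsnoc u.1 a) = v.1 then 1 else 0
  have hM : ∀ u v, 0 ≤ M u v := fun u v =>
    Finset.sum_nonneg fun a _ => by split_ifs <;> norm_num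
  have hME : ∀ u v, WordEdge X u v → 1 ≤ M u v := by
    rintro u v ⟨a, ha⟩
    refine le_trans (by rw [if_pos ha]) (Finset.single_le_sum
      (f := fun a => if Adm X (wsnoc u.1 a) ∧ Fin.tail (wsnoc u.1 a) = v.1 then (1 : ℝ) else 0)
      (fun a _ => by split_ifs <;> norm_num) (Finset.mem_univ a))
  have hpath := exists_one_le_pow_apply hM hME (reflTransGen_wordEdge hF hmix)
  have hMpow : ∀ t u v, 0 ≤ (M ^ t) u v := by
    intro t
    induction t with
    | zero => intro a b; simp only [pow_zero, Matrix.one_apply]; split_ifs <;> norm_num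
    | succ t ih =>
      intro a b
      rw [pow_succ, Matrix.mul_apply]
      exact Finset.sum_nonneg fun c _ => mul_nonneg (ih a c) (hM c b)
  obtain ⟨lam, r, hr, heig⟩ := exists_pos_eigenvector hM
    (B := ∑ t ∈ Finset.range (Fintype.card V), M ^ t)
    (fun u v => by
      obtain ⟨t, ht, h⟩ := hpath u v
      rw [Matrix.sum_apply]
      exact (zero_lt_one.trans_le h).trans_le (Finset.single_le_sum
        (f := fun t => (M ^ t) u v) (fun t _ => hMpow t u v) (Finset.mem_range.2 ht)))
    (Commute.sum_right _ _ _ fun t _ => Commute.self_pow M t)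
  have hMsum : ∀ (u : V) (φ : V → ℝ), ∑ v, M u v * φ v =
      ∑ a, if h : Adm X (wsnoc u.1 a) then φ ⟨Fin.tail (wsnoc u.1 a), h.tail hF⟩ else 0 := by
    intro u φ
    simp only [M, Finset.sum_mul]
    rw [Finset.sum_comm]
    refine Finset.sum_congr rfl fun a _ => ?_
    split_ifs with h
    · rw [Finset.sum_eq_single ⟨Fin.tail (wsnoc u.1 a), h.tail hF⟩]
      · simp [h]
      · intro v _ hv
        rw [if_neg fun h' => hv (Subtype.ext h'.2.symm), zero_mul]
      · simp
    · simp [h]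
  have heig' : ∀ u, ∑ v, M u v * r v = lam * r u := fun u => congrFun heig u
  have hlam : 0 < lam := by
    obtain ⟨u⟩ := ‹Nonempty V›
    obtain ⟨a, ha⟩ := u.2.exists_wsnoc
    have h1 := hME u ⟨Fin.tail (wsnoc u.1 a), ha.tail hF⟩ ⟨a, ha, rfl⟩
    have h2 : 0 < lam * r u := by
      rw [← heig' u]
      exact Finset.sum_pos' (fun v _ => mul_nonneg (hM u v) (hr v).le)
        ⟨_, Finset.mem_univ _, mul_pos (zero_lt_one.trans_le h1) (hr _)⟩
    exact pos_of_mul_pos_left h2 (hr u).le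
  have hlampow : ∀ t < Fintype.card V, lam ^ t ≤ (Fintype.card V : ℝ) ^ (Fintype.card V - 1) := by
    intro t ht
    have hone : (1 : ℝ) ≤ Fintype.card V := by exact_mod_cast Fintype.card_pos
    rcases Nat.eq_zero_or_pos F with hF0 | hF0
    · subst hF0
      have : Fintype.card V ≤ 1 := Fintype.card_le_one_iff_subsingleton.2 inferInstance
      rw [show t = 0 by omega, pow_zero]
      exact one_le_pow₀ hone
    · have hM1 : ∀ u v, M u v ≤ 1 := by
        intro u v
        simp only [M, Finset.sum_boole]
        norm_cast
        refine Finset.card_le_one.2 fun a ha b hb => ?_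
        simp only [Finset.mem_filter, Finset.mem_univ, true_and] at ha hb
        have h1 := congrFun (ha.2.trans hb.2.symm) ⟨F - 1, by omega⟩
        simp only [Fin.tail, wsnoc_apply, Fin.val_succ] at h1
        rwa [dif_neg (by omega), dif_neg (by omega)] at h1
      have hle : lam ≤ Fintype.card V := by
        obtain ⟨u, hu⟩ := Finite.exists_max r
        refine le_of_mul_le_mul_right ?_ (hr u)
        rw [← heig' u]
        calc ∑ v, M u v * r v ≤ ∑ v : V, r u :=
              Finset.sum_le_sum fun v _ =>
                (mul_le_of_le_one_left (hr v).le (hM1 u v)).trans (hu v)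
          _ = _ := by simp
      calc lam ^ t ≤ (Fintype.card V : ℝ) ^ t := pow_le_pow_left₀ hlam.le hle t
        _ ≤ _ := pow_le_pow_right₀ hone (by omega)
  let r' : (Fin F → A) → ℝ := fun u => if h : Adm X u then r ⟨u, h⟩ else 0
  have hr' : ∀ u : V, r' u.1 = r u := fun u => dif_pos u.2
  refine ⟨lam, r', hlam, fun u hu => (hr' ⟨u, hu⟩).symm ▸ hr _, fun u hu => dif_neg hu, ?_, ?_⟩
  · intro u
    by_cases hu : Adm X u
    · rw [hr' ⟨u, hu⟩, ← heig', hMsum]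
      refine Finset.sum_congr rfl fun a _ => ?_
      split_ifs with h
      · exact hr' ⟨_, h.tail hF⟩
      · rfl
    · rw [show r' u = 0 from dif_neg hu, mul_zero]
      exact Finset.sum_eq_zero fun a _ => if_neg fun h => hu h.of_wsnoc
  · refine exists_inv_le_pow_apply hMpow hr hlam heig ?_ hpath hlampow
    intro u v
    simp only [wordMatrix, M, Finset.sum_mul, eigenKernel]
    refine Finset.sum_congr rfl fun a _ => ?_
    by_cases h1 : Fin.tail (wsnoc u.1 a) = v.1
    · rw [h1]
      by_cases h2 : Adm X (wsnoc u.1 a) <;> simp [h2, hr']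
    · simp [h1]

open Classical in
/-- An eigenvalue of the transfer operator bounds the topological entropy from below. -/
lemma log_le_subshiftEntropy [Fintype A] (hX : X.Nonempty) (hF : sftCover X F = X) {lam : ℝ}
    {r : (Fin F → A) → ℝ} (hlam : 0 < lam) (hr : ∀ u, Adm X u → 0 < r u)
    (heig : ∀ u, ∑ a, (if Adm X (wsnoc u a) then r (Fin.tail (wsnoc u a)) else 0) =
      lam * r u) :
    Real.log lam ≤ subshiftEntropy X := by
  obtain ⟨x, hx⟩ := hX
  have : Nonempty A := ⟨x 0⟩
  let N : ℕ → ℕ := fun n => Fintype.card {w : Fin n → A // Adm X w}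
  have hN : ∀ n, Nat.card {w : List A // w.length = n ∧ inLang X w} = N n := fun n => by
    rw [card_inLang, Nat.card_eq_fintype_card]
  have hNpos : ∀ n, 0 < N n := fun n => Fintype.card_pos_iff.2 ⟨⟨_, adm_window hF hx 0 n⟩⟩
  let R : ∀ n, F ≤ n → ℝ := fun n h =>
    ∑ w : Fin n → A, if Adm X w then r (wsuffix h w) else 0
  have hR : ∀ n h, R (n + 1) (h.trans n.le_succ) = lam * R n h := by
    intro n h
    simp only [R, Finset.mul_sum]
    rw [sum_wsnoc]
    refine Finset.sum_congr rfl fun w _ => ?_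
    by_cases hw : Adm X w
    · rw [if_pos hw, ← heig]
      refine Finset.sum_congr rfl fun a _ => ?_
      rw [wsuffix_wsnoc h]
      refine if_congr ⟨fun h' => h'.suffix_wsnoc hF h, fun h' => hw.wsnoc_of_suffix hF h h'⟩ rfl rfl
    · rw [if_neg hw, mul_zero]
      exact Finset.sum_eq_zero fun a _ => if_neg fun h => hw h.of_wsnoc
  have hR0 : 0 < R F le_rfl := by
    refine Finset.sum_pos' (fun w _ => ?_)
      ⟨_, Finset.mem_univ (fun j : Fin F => x (0 + (j : ℕ))), ?_⟩
    · split_ifs with h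
      · rw [wsuffix_self]
        exact (hr w h).le
      · exact le_rfl
    · rw [if_pos (adm_window hF hx 0 F), wsuffix_self]
      exact hr _ (adm_window hF hx 0 F)
  obtain ⟨u, hu⟩ := Finite.exists_max r
  have hRpow : ∀ n h, lam ^ n * R F le_rfl = lam ^ F * R n h := by
    intro n h
    induction n, h using Nat.le_induction with
    | base => rfl
    | succ n h ih => rw [hR n h, pow_succ, mul_right_comm, ih]; ring
  have hRle : ∀ n h, R n h ≤ N n * r u := by
    intro n h
    simp only [R, N]
    rw [← Finset.sum_filter]
    refine (Finset.sum_le_card_nsmul _ _ (r u) fun w _ => hu _).trans_eq ?_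
    rw [nsmul_eq_mul, Fintype.card_subtype]
  have hru : 0 < r u := (hr _ (adm_window hF hx 0 F)).trans_le (hu _)
  set c : ℝ := R F le_rfl / (lam ^ F * r u) with hc
  have hc0 : 0 < c := by positivity
  have hlow : ∀ n, F ≤ n → Real.log c + n * Real.log lam ≤ Real.log (N n) := by
    intro n h
    rw [← Real.log_pow, ← Real.log_mul hc0.ne' (by positivity)]
    refine Real.log_le_log (by positivity) ?_
    rw [hc, div_mul_eq_mul_div, div_le_iff₀ (by positivity), mul_comm (R F _), hRpow n h]
    calc lam ^ F * R n h ≤ lam ^ F * (N n * r u) :=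
          mul_le_mul_of_nonneg_left (hRle n h) (by positivity)
      _ = _ := by ring
  have hlim : Tendsto (fun n : ℕ => Real.log c / n + Real.log lam) atTop (𝓝 (Real.log lam)) := by
    simpa using (tendsto_const_div_atTop_nhds_zero_nat (Real.log c)).add_const (Real.log lam)
  have hev : ∀ᶠ n : ℕ in atTop, 0 < n := eventually_gt_atTop 0
  simp only [subshiftEntropy, hN]
  rw [← hlim.limsup_eq]
  refine limsup_le_limsup ?_ hlim.isBoundedUnder_ge.isCoboundedUnder_le
    ⟨Real.log (Fintype.card A), eventually_map.2 ?_⟩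
  · filter_upwards [eventually_ge_atTop F, hev] with n hn hn0
    have hn0' : (0 : ℝ) < n := by exact_mod_cast hn0
    rw [div_add' _ _ _ hn0'.ne']
    gcongr
    linarith [hlow n hn]
  · filter_upwards [hev] with n hn
    have hn0' : (0 : ℝ) < n := by exact_mod_cast hn
    rw [div_le_iff₀ hn0', mul_comm, ← Real.log_pow]
    refine Real.log_le_log (by exact_mod_cast hNpos n) ?_
    have := Fintype.card_subtype_le (fun w : Fin n → A => Adm X w)
    rw [Fintype.card_fun, Fintype.card_fin] at this
    exact_mod_cast this

end Language

/-- The mass that `μ` gives to the cylinder of `w`. -/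
noncomputable def cylinderMass {A : Type*} [MeasurableSpace A] (μ : Measure (ℤ → A)) (n : ℕ)
    (w : Fin n → A) : ℝ :=
  (μ {x : ℤ → A | ∀ j : Fin n, x ((j : ℕ) : ℤ) = w j}).toReal

section Measures

variable {A : Type*} [MeasurableSpace A]

lemma cylinderMass_eq_zero {X : Set (ℤ → A)} {μ : Measure (ℤ → A)} (hμ : μ Xᶜ = 0) {n : ℕ}
    {w : Fin n → A} (hw : ¬ Adm X w) : cylinderMass μ n w = 0 := by
  have : μ {x : ℤ → A | ∀ j : Fin n, x ((j : ℕ) : ℤ) = w j} = 0 :=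
    measure_mono_null (fun x hx hxX => hw ⟨x, hxX, hx⟩) hμ
  rw [cylinderMass, this, ENNReal.toReal_zero]

variable [MeasurableSingletonClass A]

lemma measurableSet_cylinder {n : ℕ} (w : Fin n → A) :
    MeasurableSet {x : ℤ → A | ∀ j : Fin n, x ((j : ℕ) : ℤ) = w j} := by
  have h (j : Fin n) : MeasurableSet {x : ℤ → A | x ((j : ℕ) : ℤ) = w j} :=
    measurableSet_preimage (f := fun x : ℤ → A => x ((j : ℕ) : ℤ)) (measurable_pi_apply _)
      (measurableSet_singleton (w j))
  rw [Set.ofPred_forall]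
  exact MeasurableSet.iInter h

lemma isStationaryFamily_cylinderMass [Fintype A] {μ : Measure (ℤ → A)} [IsProbabilityMeasure μ]
    (hμ : Measure.map (shiftMap A) μ = μ) : IsStationaryFamily (cylinderMass μ) where
  nonneg _ _ := ENNReal.toReal_nonneg
  sum_snoc n w := by
    have h : {x : ℤ → A | ∀ j : Fin n, x ((j : ℕ) : ℤ) = w j} =
        ⋃ a, {x : ℤ → A | ∀ j : Fin (n + 1), x ((j : ℕ) : ℤ) = wsnoc w a j} := by
      ext x
      simp [Fin.forall_fin_succ']
    simp only [cylinderMass]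
    rw [h]
    refine (measureReal_iUnion_fintype (fun a b hab => ?_)
      fun a => measurableSet_cylinder _).symm
    refine Set.disjoint_left.2 fun x hxa hxb => hab ?_
    simpa [wsnoc] using (hxa (Fin.last n)).symm.trans (hxb (Fin.last n))
  sum_cons n w := by
    have h : shiftMap A ⁻¹' {x : ℤ → A | ∀ j : Fin n, x ((j : ℕ) : ℤ) = w j} =
        ⋃ a, {x : ℤ → A | ∀ j : Fin (n + 1), x ((j : ℕ) : ℤ) = wcons a w j} := by
      ext x
      simp [Fin.forall_fin_succ, shiftMap]
    have hmeas : Measurable (shiftMap A) :=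
      measurable_pi_lambda _ fun i => measurable_pi_apply (i + 1)
    simp only [cylinderMass]
    conv_rhs => rw [← hμ, Measure.map_apply hmeas (measurableSet_cylinder w), h]
    refine (measureReal_iUnion_fintype (fun a b hab => ?_)
      fun a => measurableSet_cylinder _).symm
    refine Set.disjoint_left.2 fun x hxa hxb => hab ?_
    simpa [wcons] using (hxa 0).symm.trans (hxb 0)
  total := by simp [cylinderMass]

open Classical in
/-- Effective comparison of two shift-invariant measures of almost maximal entropy. -/
lemma sum_abs_cylinderMass_sub_le [Fintype A] {X : Set (ℤ → A)} (hX : X.Nonempty)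
    (hmix : TopMixing X) {F : ℕ} (hF : sftCover X F = X)
    {μ μ' : Measure (ℤ → A)} [IsProbabilityMeasure μ] [IsProbabilityMeasure μ']
    (hμ : Measure.map (shiftMap A) μ = μ) (hμ' : Measure.map (shiftMap A) μ' = μ')
    (hμX : μ Xᶜ = 0) (hμ'X : μ' Xᶜ = 0) {δ δ' : ℝ}
    (hδ : subshiftEntropy X - δ ≤ measEntropy μ) (hδ' : subshiftEntropy X - δ' ≤ measEntropy μ')
    (n : ℕ) :
    ∑ w, |cylinderMass μ n w - cylinderMass μ' n w| ≤
      (Fintype.card {u : Fin F → A // Adm X u} *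
        ((Fintype.card {u : Fin F → A // Adm X u} : ℝ) ^
          (Fintype.card {u : Fin F → A // Adm X u} - 1)) ^ 2 + n) * (2 * √δ + 2 * √δ') := by
  obtain ⟨lam, r, hlam, hr, hr0, heig, hc⟩ := exists_eigenData hX hF hmix
  have hlog := log_le_subshiftEntropy hX hF hlam hr heig
  set s := Fintype.card {u : Fin F → A // Adm X u} with hs
  have hs0 : 0 < s := by
    obtain ⟨x, hx⟩ := hX
    exact Fintype.card_pos_iff.2 ⟨⟨_, adm_window hF hx 0 F⟩⟩
  have hs0' : (0 : ℝ) < s := by exact_mod_cast hs0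
  set K := eigenKernel (fun u a => Adm X (wsnoc u a)) r lam with hK
  have hrE : ∀ (u : Fin F → A) a, Adm X (wsnoc u a) → 0 < r u ∧ 0 < r (Fin.tail (wsnoc u a)) :=
    fun u a h => ⟨hr _ h.of_wsnoc, hr _ (h.tail hF)⟩
  have hKnonneg : ∀ u a, 0 ≤ K u a := eigenKernel_nonneg hlam hrE
  have hKone : ∀ u, Adm X u → ∑ a, K u a = 1 := fun u hu => sum_eigenKernel hlam heig (hr u hu)
  have hKadm : ∀ u a, K u a ≠ 0 → Adm X (wsnoc u a) := by
    intro u a h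
    by_contra hne
    exact h (if_neg hne)
  have hKle : ∀ u, ∑ a, K u a ≤ 1 := by
    intro u
    by_cases hu : Adm X u
    · exact (hKone u hu).le
    · refine (Finset.sum_eq_zero fun a _ => ?_).trans_le zero_le_one
      by_contra hne
      exact hu (hKadm u a hne).of_wsnoc
  have hmarkov : ∀ (ν : Measure (ℤ → A)) [IsProbabilityMeasure ν],
      Measure.map (shiftMap A) ν = ν → ν Xᶜ = 0 → ∀ δ, subshiftEntropy X - δ ≤ measEntropy ν →
      ∀ n (h : F ≤ n), ∑ w : Fin n → A, ∑ a, |cylinderMass ν (n + 1) (wsnoc w a) -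
        cylinderMass ν n w * K (wsuffix h w) a| ≤ 2 * √δ := by
    intro ν _ hν hνX δ hδ n h
    have hf := isStationaryFamily_cylinderMass hν
    refine hf.sum_abs_sub_mul_eigenKernel_le hlam hrE heig h (fun w a hne => ?_) ?_
    · by_contra hadm
      exact hne (cylinderMass_eq_zero hνX fun h' => hadm (h'.suffix_wsnoc hF h))
    · have h1 : measEntropy ν ≤ _ := hf.limsup_blockEntropy_div_le n
      linarith
  have hf := isStationaryFamily_cylinderMass hμ
  have hg := isStationaryFamily_cylinderMass hμ'
  have hbase : ∑ w, |cylinderMass μ F w - cylinderMass μ' F w| ≤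
      s * ((s : ℝ) ^ (s - 1)) ^ 2 * (2 * √δ + 2 * √δ') := by
    have h1 := hmarkov μ hμ hμX δ hδ F le_rfl
    have h2 := hmarkov μ' hμ' hμ'X δ' hδ' F le_rfl
    simp only [wsuffix_self] at h1 h2
    have key := hf.mul_sum_abs_sub_le hg (p := Adm X) (fun u => cylinderMass_eq_zero hμX)
      (fun u => cylinderMass_eq_zero hμ'X) hKnonneg hKone
      (fun u a h => (hKadm u a h).tail hF) hc h1 h2
    rw [inv_mul_le_iff₀ (by positivity), ← hs] at key
    linarith
  have hη : 0 ≤ 2 * √δ + 2 * √δ' := by positivity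
  rcases le_total n F with hn | hn
  · have hmono : ∑ w, |cylinderMass μ n w - cylinderMass μ' n w| ≤
        ∑ w, |cylinderMass μ F w - cylinderMass μ' F w| :=
      monotone_nat_of_le_succ (f := fun n => ∑ w, |cylinderMass μ n w - cylinderMass μ' n w|)
        (hf.sum_abs_sub_le_succ hg) hn
    have := mul_nonneg (Nat.cast_nonneg (α := ℝ) n) hη
    linarith
  · induction n, hn using Nat.le_induction with
    | base =>
      have := mul_nonneg (Nat.cast_nonneg (α := ℝ) F) hη
      linarith
    | succ n hn ih =>
      have := IsStationaryFamily.sum_abs_sub_succ_le hKnonneg hKle hn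
        (hmarkov μ hμ hμX δ hδ n hn) (hmarkov μ' hμ' hμ'X δ' hδ' n hn)
      push_cast
      linarith

end Measures

lemma le_xi {s : ℕ} (hs : 0 < s) : 30 * (s : ℝ) ^ (3 * (s ^ 2 + 1)) ≤ xi s := by
  have hs1 : (1 : ℝ) ≤ s := by exact_mod_cast hs
  have hpow : (1 : ℝ) ≤ (s : ℝ) ^ (2 * s ^ 2) := one_le_pow₀ hs1
  have hx0 : 0 < 1 / (4 * (s : ℝ) ^ (2 * s ^ 2)) := by positivity
  have hx1 : 1 / (4 * (s : ℝ) ^ (2 * s ^ 2)) ≤ 1 := by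
    rw [div_le_one (by positivity)]
    linarith
  have hlt : Real.rpow (1 - 1 / (4 * (s : ℝ) ^ (2 * s ^ 2))) (1 / (s ^ 2 : ℝ)) < 1 :=
    Real.rpow_lt_one (by linarith) (by linarith) (by positivity)
  have hge : 0 ≤ Real.rpow (1 - 1 / (4 * (s : ℝ) ^ (2 * s ^ 2))) (1 / (s ^ 2 : ℝ)) :=
    Real.rpow_nonneg (by linarith) _
  rw [xi, le_div_iff₀ (by linarith)]
  exact mul_le_of_le_one_right (by positivity) (by linarith)

lemma card_mul_pow_add_lt {s : ℕ} (hs : 0 < s) {n ℓ : ℕ} (hn : n ≤ ℓ) :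
    2 * (s * ((s : ℝ) ^ (s - 1)) ^ 2 + n) < (4 / 3 : ℝ) ^ ℓ * xi s := by
  have hs1 : (1 : ℝ) ≤ s := by exact_mod_cast hs
  set B : ℝ := (s : ℝ) ^ (3 * (s ^ 2 + 1)) with hB
  have hB1 : 1 ≤ B := one_le_pow₀ hs1
  have hsB : s * ((s : ℝ) ^ (s - 1)) ^ 2 ≤ B := by
    rw [← pow_mul, ← pow_succ']
    refine pow_le_pow_right₀ hs1 ?_
    have : s ≤ s ^ 2 := Nat.le_self_pow two_ne_zero s
    omega
  have hbern := one_add_mul_le_pow (show (-2 : ℝ) ≤ 1 / 3 by norm_num) ℓ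
  norm_num at hbern
  have hn' : (n : ℝ) ≤ ℓ := by exact_mod_cast hn
  have hℓ0 : (0 : ℝ) ≤ ℓ := ℓ.cast_nonneg
  have hq1 : (1 : ℝ) ≤ (4 / 3 : ℝ) ^ ℓ := by linarith
  calc 2 * (s * ((s : ℝ) ^ (s - 1)) ^ 2 + n) ≤ 2 * (B + 3 * (4 / 3 : ℝ) ^ ℓ) := by linarith
    _ ≤ 8 * ((4 / 3 : ℝ) ^ ℓ * B) := by nlinarith
    _ < (4 / 3 : ℝ) ^ ℓ * (30 * B) := by nlinarith
    _ ≤ _ := by gcongr; exact le_xi hs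

theorem effective_intrinsic_ergodicity {A : Type*} [Fintype A]
    [TopologicalSpace A] [DiscreteTopology A] [MeasurableSpace A] [BorelSpace A]
    (X : Set (ℤ → A)) (hX : IsSubshift X) (hmix : TopMixing X)
    (F : ℕ) (hF : sftCover X F = X)
    (s : ℕ) (hs : s = Nat.card { w : List A // w.length = F ∧ inLang X w })
    (μ : MeasureTheory.Measure (ℤ → A)) (hμprob : MeasureTheory.IsProbabilityMeasure μ)
    (hμinv : MeasureTheory.Measure.map (shiftMap A) μ = μ) (hμsupp : μ Xᶜ = 0)
    (hμmax : measEntropy μ = subshiftEntropy X)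
    (ε : ℝ) (hε : 0 < ε) (ℓ : ℕ)
    (μ' : MeasureTheory.Measure (ℤ → A)) (hμ'prob : MeasureTheory.IsProbabilityMeasure μ')
    (hμ'inv : MeasureTheory.Measure.map (shiftMap A) μ' = μ') (hμ'supp : μ' Xᶜ = 0)
    (hent : measEntropy μ' >
      subshiftEntropy X - ε ^ 2 / ((4 / 3 : ℝ) ^ (2 * ℓ) * (xi s) ^ 2)) :
    ∀ w : List A, inLang X w → w.length ≤ ℓ →
      |(μ' { x | occursAt x 0 w }).toReal - (μ { x | occursAt x 0 w }).toReal| < ε := by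
  classical
  intro w _ hw
  have hs' : Fintype.card {u : Fin F → A // Adm X u} = s := by
    rw [hs, card_inLang, Nat.card_eq_fintype_card]
  have hspos : 0 < s := by
    obtain ⟨x, hx⟩ := hX.1
    rw [← hs']
    exact Fintype.card_pos_iff.2 ⟨⟨_, adm_window hF hx 0 F⟩⟩
  have hlt := card_mul_pow_add_lt hspos hw
  have hD : 0 < (4 / 3 : ℝ) ^ ℓ * xi s := lt_of_le_of_lt (by positivity) hlt
  have hcyl : ∀ ν : Measure (ℤ → A), (ν {x | occursAt x 0 w}).toReal =
      cylinderMass ν w.length w.get := by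
    intro ν
    simp only [cylinderMass, occursAt, zero_add]
  have key := sum_abs_cylinderMass_sub_le hX.1 hmix hF hμ'inv hμinv hμ'supp hμsupp hent.le
    (by rw [hμmax, sub_zero] : subshiftEntropy X - 0 ≤ measEntropy μ) w.length
  rw [hs', Real.sqrt_zero, mul_zero, add_zero,
    show ε ^ 2 / ((4 / 3 : ℝ) ^ (2 * ℓ) * xi s ^ 2) = (ε / ((4 / 3 : ℝ) ^ ℓ * xi s)) ^ 2 by
      rw [div_pow ε, mul_pow, ← pow_mul, mul_comm ℓ 2], Real.sqrt_sq (by positivity)] at key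
  rw [hcyl, hcyl]
  calc |cylinderMass μ' w.length w.get - cylinderMass μ w.length w.get|
      ≤ ∑ v, |cylinderMass μ' w.length v - cylinderMass μ w.length v| :=
        Finset.single_le_sum
          (f := fun v => |cylinderMass μ' w.length v - cylinderMass μ w.length v|)
          (fun v _ => abs_nonneg _) (Finset.mem_univ w.get)
    _ ≤ 2 * (s * ((s : ℝ) ^ (s - 1)) ^ 2 + w.length) * (ε / ((4 / 3 : ℝ) ^ ℓ * xi s)) := by
        linarith
    _ < ((4 / 3 : ℝ) ^ ℓ * xi s) * (ε / ((4 / 3 : ℝ) ^ ℓ * xi s)) :=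
        mul_lt_mul_of_pos_right hlt (by positivity)
    _ = ε := mul_div_cancel₀ _ hD.ne'
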